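/- Let 𝓕 be an ω-closed family of nonempty inductive subsets of ω and let S = B_ω^𝓕 ∪ {0} be B_ω^𝓕 with an adjoined zero, equipped with a Hausdorff locally compact shift-continuous topology in which 0 is not an isolated point. Then for every neighbourhood U of 0 in S and every F ∈ 𝓕, the set B_ω^{F} \ U is finite. -/

import Mathlib

/-- For `n : ℕ` and `F ⊆ ω`, `wShift n F` is the set `(−n)+F = {x ∈ ω : x + n ∈ F}`. -/
def wShift (n : ℕ) (F : Set ℕ) : Set ℕ := {x | x + n ∈ F}

/-- A family `𝓕` of subsets of `ω` is ω-closed if `F₁ ∩ ((−n)+F₂) ∈ 𝓕`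
for all `n ∈ ω` and `F₁, F₂ ∈ 𝓕`. -/
def OmegaClosed (𝓕 : Set (Set ℕ)) : Prop :=
  ∀ n : ℕ, ∀ F₁ ∈ 𝓕, ∀ F₂ ∈ 𝓕, F₁ ∩ wShift n F₂ ∈ 𝓕

/-- A subset `F ⊆ ω` is inductive if `n ∈ F` implies `n+1 ∈ F`. -/
def InductiveSet (F : Set ℕ) : Prop := ∀ n : ℕ, n ∈ F → n + 1 ∈ F

/-- The underlying set `ω × ω × 𝓕` of the semigroup `B_ω^𝓕`. -/
abbrev BF (𝓕 : Set (Set ℕ)) : Type := ℕ × ℕ × {F : Set ℕ // F ∈ 𝓕}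

/-- The multiplication of the semigroup `B_ω^𝓕`:
`(i₁,j₁,F₁)·(i₂,j₂,F₂) = (i₁−j₁+i₂, j₂, ((j₁−i₂)+F₁) ∩ F₂)` if `j₁ ≤ i₂`, and
`(i₁, j₁−i₂+j₂, F₁ ∩ ((i₂−j₁)+F₂))` if `j₁ ≥ i₂`. -/
def BFmul {𝓕 : Set (Set ℕ)} (h : OmegaClosed 𝓕) (a b : BF 𝓕) : BF 𝓕 :=
  if a.2.1 ≤ b.1 then
    (a.1 + (b.1 - a.2.1), b.2.1,
      ⟨wShift (b.1 - a.2.1) a.2.2.1 ∩ b.2.2.1, by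
        rw [Set.inter_comm]; exact h _ _ b.2.2.2 _ a.2.2.2⟩)
  else
    (a.1, b.2.1 + (a.2.1 - b.1),
      ⟨a.2.2.1 ∩ wShift (a.2.1 - b.1) b.2.2.1, h _ _ a.2.2.2 _ b.2.2.2⟩)

/-- `B_ω^𝓕` with an adjoined zero; `none` plays the role of the zero `0`. -/
abbrev BF0 (𝓕 : Set (Set ℕ)) : Type := Option (BF 𝓕)

/-- The multiplication of the semigroup `B_ω^𝓕` with an adjoined zero. -/
def BF0mul {𝓕 : Set (Set ℕ)} (h : OmegaClosed 𝓕) : BF0 𝓕 → BF0 𝓕 → BF0 𝓕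
  | some a, some b => some (BFmul h a b)
  | _, _ => none

theorem InductiveSet.eq_Ici {F : Set ℕ} (hF : InductiveSet F) (hne : F.Nonempty) :
    F = Set.Ici (sInf F) := by
  ext n
  refine ⟨fun h => Nat.sInf_le h, fun h => ?_⟩
  induction n, (show sInf F ≤ n from h) using Nat.le_induction with
  | base => exact Nat.sInf_mem hne
  | succ n hn ih => exact hF n (ih hn)

theorem wShift_Ici (n k : ℕ) : wShift n (Set.Ici k) = Set.Ici (k - n) := by
  ext x
  simp [wShift]

namespace BF0

variable {𝓕 : Set (Set ℕ)}

/-- The element `(i, j, [k, ∞))` of `B_ω^𝓕`, viewed in `B_ω^𝓕` with an adjoined zero. -/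
def mk (i j k : ℕ) (h : Set.Ici k ∈ 𝓕) : BF0 𝓕 := some (i, j, ⟨Set.Ici k, h⟩)

theorem mk_ne_none (i j k : ℕ) (h : Set.Ici k ∈ 𝓕) : mk i j k h ≠ none := by
  simp [mk]

theorem mk_inj {i j k p q l : ℕ} {h : Set.Ici k ∈ 𝓕} {h' : Set.Ici l ∈ 𝓕}
    (e : mk i j k h = mk p q l h') : i = p ∧ j = q ∧ k = l := by
  simpa [mk, Set.Ici_inj] using e

theorem exists_eq_mk (hne : ∀ F ∈ 𝓕, F.Nonempty) (hind : ∀ F ∈ 𝓕, InductiveSet F)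
    (x : BF0 𝓕) : x = none ∨ ∃ i j k h, x = mk i j k h := by
  rcases x with _ | ⟨i, j, F, hF⟩
  · exact Or.inl rfl
  · have e := (hind F hF).eq_Ici (hne F hF)
    exact Or.inr ⟨i, j, sInf F, e ▸ hF, by simp [mk, ← e]⟩

theorem max_sub_mem (hcl : OmegaClosed 𝓕) {i k l : ℕ} (hk : Set.Ici k ∈ 𝓕)
    (hl : Set.Ici l ∈ 𝓕) : Set.Ici (max k (l - i)) ∈ 𝓕 := by
  have h := hcl i _ hk _ hl
  rwa [wShift_Ici, Set.Ici_inter_Ici] at h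

theorem mul_mk (hcl : OmegaClosed 𝓕) {i j k p q l s t r : ℕ} (hk : Set.Ici k ∈ 𝓕)
    (hl : Set.Ici l ∈ 𝓕) (hr : Set.Ici r ∈ 𝓕) (es : s = i + (p - j)) (et : t = q + (j - p))
    (er : r = max (k - (p - j)) (l - (j - p))) :
    BF0mul hcl (mk i j k hk) (mk p q l hl) = mk s t r hr := by
  subst es et er
  simp only [mk, BF0mul, BFmul, wShift_Ici, Set.Ici_inter_Ici]
  split_ifs with h
  · simp [Nat.sub_eq_zero_of_le h]
  · simp [Nat.sub_eq_zero_of_le (Nat.le_of_not_le h)]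

theorem exists_mul_mk (hcl : OmegaClosed 𝓕) (i j k p q l : ℕ) (hk : Set.Ici k ∈ 𝓕)
    (hl : Set.Ici l ∈ 𝓕) : ∃ hr, BF0mul hcl (mk i j k hk) (mk p q l hl) =
      mk (i + (p - j)) (q + (j - p)) (max (k - (p - j)) (l - (j - p))) hr := by
  have hr : Set.Ici (max (k - (p - j)) (l - (j - p))) ∈ 𝓕 := by
    rcases Nat.le_total j p with h | h
    · simpa [Nat.sub_eq_zero_of_le h, max_comm] using max_sub_mem hcl (i := p - j) hl hk
    · simpa [Nat.sub_eq_zero_of_le h] using max_sub_mem hcl (i := j - p) hk hl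
  exact ⟨hr, mul_mk hcl hk hl hr rfl rfl rfl⟩

theorem mul_none (hcl : OmegaClosed 𝓕) (x : BF0 𝓕) : BF0mul hcl x none = none := by
  cases x <;> rfl

theorem none_mul (hcl : OmegaClosed 𝓕) (x : BF0 𝓕) : BF0mul hcl none x = none := rfl

/-- The coordinates `(i, j, min F)` of an element `(i, j, F)`. -/
noncomputable def code (x : BF0 𝓕) : Option (ℕ × ℕ × ℕ) :=
  x.map fun y => (y.1, y.2.1, sInf y.2.2.1)

theorem code_mk (i j k : ℕ) (h : Set.Ici k ∈ 𝓕) : code (mk i j k h) = some (i, j, k) := by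
  simp [code, mk]

theorem code_injective (hne : ∀ F ∈ 𝓕, F.Nonempty) (hind : ∀ F ∈ 𝓕, InductiveSet F) :
    Function.Injective (code (𝓕 := 𝓕)) := by
  refine Option.map_injective ?_
  rintro ⟨i, j, F, hF⟩ ⟨p, q, G, hG⟩ e
  simp only [Prod.mk.injEq] at e
  obtain ⟨rfl, rfl, e⟩ := e
  have : F = G := by rw [(hind F hF).eq_Ici (hne F hF), (hind G hG).eq_Ici (hne G hG), e]
  subst this
  rfl

theorem finite_of_bounded (hne : ∀ F ∈ 𝓕, F.Nonempty) (hind : ∀ F ∈ 𝓕, InductiveSet F)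
    {A : Set (BF0 𝓕)} (N : ℕ) (hA : ∀ i j k h, mk i j k h ∈ A → i + j + k ≤ N) :
    A.Finite := by
  refine (((Set.finite_Iic ((N, N, N) : ℕ × ℕ × ℕ)).image some |>.insert none).preimage
    (code_injective hne hind).injOn).subset fun x hx => ?_
  rcases exists_eq_mk hne hind x with rfl | ⟨i, j, k, h, rfl⟩
  · exact Or.inl rfl
  · have := hA i j k h hx
    refine Or.inr ⟨(i, j, k), ?_, (code_mk i j k h).symm⟩
    simp only [Set.mem_Iic, Prod.mk_le_mk]
    omega

theorem exists_bound {A : Set (BF0 𝓕)} (hA : A.Finite) :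
    ∃ N, ∀ i j k h, N ≤ i + j + k → mk i j k h ∉ A := by
  obtain ⟨N, hN⟩ := (hA.image fun x => x.elim 0 fun y => y.1 + y.2.1 + sInf y.2.2.1).bddAbove
  refine ⟨N + 1, fun i j k h hle hmem => ?_⟩
  have := hN ⟨_, hmem, rfl⟩
  simp [mk] at this
  omega

theorem finite_mul_left_fiber (hcl : OmegaClosed 𝓕) (hne : ∀ F ∈ 𝓕, F.Nonempty)
    (hind : ∀ F ∈ 𝓕, InductiveSet F) {u y : BF0 𝓕} (hy : y ≠ none) :
    ((fun x => BF0mul hcl u x) ⁻¹' {y}).Finite := by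
  rcases exists_eq_mk hne hind y with rfl | ⟨s, t, r, hr, rfl⟩
  · exact absurd rfl hy
  rcases exists_eq_mk hne hind u with rfl | ⟨i, j, k, hk, rfl⟩
  · simp [none_mul, Ne.symm hy]
  refine finite_of_bounded hne hind (s + j + t + r + j) fun p q l hl e => ?_
  obtain ⟨_, e'⟩ := exists_mul_mk hcl i j k p q l hk hl
  have := mk_inj (e'.symm.trans e)
  omega

theorem finite_mul_right_fiber (hcl : OmegaClosed 𝓕) (hne : ∀ F ∈ 𝓕, F.Nonempty)
    (hind : ∀ F ∈ 𝓕, InductiveSet F) {u y : BF0 𝓕} (hy : y ≠ none) :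
    ((fun x => BF0mul hcl x u) ⁻¹' {y}).Finite := by
  rcases exists_eq_mk hne hind y with rfl | ⟨s, t, r, hr, rfl⟩
  · exact absurd rfl hy
  rcases exists_eq_mk hne hind u with rfl | ⟨p, q, l, hl, rfl⟩
  · simp [mul_none, Ne.symm hy]
  refine finite_of_bounded hne hind (s + t + p + r + p) fun i j k hk e => ?_
  obtain ⟨_, e'⟩ := exists_mul_mk hcl i j k p q l hk hl
  have := mk_inj (e'.symm.trans e)
  omega

theorem isOpen_singleton_of_finite_fiber {X Y : Type*} [TopologicalSpace X] [T1Space X]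
    [TopologicalSpace Y] {f : X → Y} (hf : Continuous f) {x : X} (hx : IsOpen {f x})
    (hfin : (f ⁻¹' {f x}).Finite) : IsOpen {x} := by
  have h : {x} = f ⁻¹' {f x} \ (f ⁻¹' {f x} \ {x}) := by
    rw [Set.sdiff_sdiff_cancel_left]
    simp
  rw [h]
  exact (hx.preimage hf).sdiff (hfin.subset Set.sdiff_subset).isClosed

theorem isOpen_singleton_of_ne_none (hcl : OmegaClosed 𝓕) (hne : ∀ F ∈ 𝓕, F.Nonempty)
    (hind : ∀ F ∈ 𝓕, InductiveSet F) [TopologicalSpace (BF0 𝓕)] [T2Space (BF0 𝓕)]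
    [LocallyCompactSpace (BF0 𝓕)]
    (hsc : ∀ a : BF0 𝓕, Continuous (fun x => BF0mul hcl a x) ∧
      Continuous (fun x => BF0mul hcl x a))
    (hni : ¬ IsOpen {(none : BF0 𝓕)}) {y : BF0 𝓕} (hy : y ≠ none) : IsOpen {y} := by
  have : Countable (BF0 𝓕) := (code_injective hne hind).countable
  obtain ⟨x, z, hz⟩ := nonempty_interior_of_iUnion_of_closed
    (f := fun x : BF0 𝓕 => ({x} : Set (BF0 𝓕))) (fun x => isClosed_singleton)
    (by ext x; simp)
  obtain rfl : z = x := Set.mem_singleton_iff.1 (interior_subset hz)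
  have hx : IsOpen {z} := by
    have : interior {z} = {z} :=
      interior_subset.antisymm (Set.singleton_subset_iff.2 hz)
    exact this ▸ isOpen_interior
  rcases exists_eq_mk hne hind z with rfl | ⟨i, j, k, hk, rfl⟩
  · exact absurd hx hni
  rcases exists_eq_mk hne hind y with rfl | ⟨p, q, l, hl, rfl⟩
  · exact absurd rfl hy
  have e₁ : BF0mul hcl (mk i (p + (l - k)) k hk) (mk p q l hl) = mk i (q + (l - k)) k hk :=
    mul_mk hcl _ _ _ (by omega) (by omega) (by omega)
  have e₂ : BF0mul hcl (mk i (q + (l - k)) k hk) (mk (q + (l - k)) j k hk) = mk i j k hk :=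
    mul_mk hcl _ _ _ (by omega) (by omega) (by omega)
  have h₂ : IsOpen {mk i (q + (l - k)) k hk} :=
    isOpen_singleton_of_finite_fiber (hsc (mk (q + (l - k)) j k hk)).2
      (by simpa only [e₂] using hx)
      (by simpa only [e₂] using finite_mul_right_fiber hcl hne hind (mk_ne_none i j k hk))
  exact isOpen_singleton_of_finite_fiber (hsc (mk i (p + (l - k)) k hk)).1
    (by simpa only [e₁] using h₂)
    (by simpa only [e₁] using finite_mul_left_fiber hcl hne hind (mk_ne_none _ _ _ _))

theorem finite_diff_of_isCompact {X : Type*} [TopologicalSpace X] {a : X}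
    (hiso : ∀ x ≠ a, IsOpen {x}) {C V : Set X} (hC : IsCompact C) (hV : V ∈ nhds a) :
    (C \ V).Finite := by
  classical
  obtain ⟨t, -, ht⟩ := hC.elim_nhds_subcover (fun x => if x = a then V else {x}) fun x _ => by
    by_cases h : x = a
    · simpa [h] using hV
    · simpa [h] using (hiso x h).mem_nhds rfl
  refine t.finite_toSet.subset fun x hx => ?_
  obtain ⟨y, hy, hxy⟩ := Set.mem_iUnion₂.1 (ht hx.1)
  by_cases h : y = a
  · exact absurd (by simpa [h] using hxy) hx.2
  · have : x = y := by simpa [h] using hxy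
    exact this ▸ hy

/-- If a set `P` of pairs contains a pair of sum at least `N`, and is closed under unit steps in
each coordinate starting from pairs of sum at least `N`, then it contains all pairs of sum at
least `N`. -/
theorem forall_of_unit_steps {P : ℕ → ℕ → Prop} {N : ℕ}
    (h₁ : ∀ i j, N ≤ i + j → P i j → P (i + 1) j)
    (h₂ : ∀ i j, N ≤ i + 1 + j → P (i + 1) j → P i j)
    (h₃ : ∀ i j, N ≤ i + j → P i j → P i (j + 1))
    (h₄ : ∀ i j, N ≤ i + (j + 1) → P i (j + 1) → P i j)
    {a b : ℕ} (hab : N ≤ a + b) (h : P a b) {i j : ℕ} (hij : N ≤ i + j) : P i j := by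
  have up₁ : ∀ n, P (a + n) b := fun n => by
    induction n with
    | zero => exact h
    | succ n ih => exact h₁ (a + n) b (by omega) ih
  have up₂ : ∀ n, P (a + (N + i)) (b + n) := fun n => by
    induction n with
    | zero => exact up₁ _
    | succ n ih => exact h₃ (a + (N + i)) (b + n) (by omega) ih
  have down₂ : ∀ n, P (a + (N + i)) (j + n) → P (a + (N + i)) j := fun n => by
    induction n with
    | zero => exact id
    | succ n ih => exact fun hn => ih (h₄ (a + (N + i)) (j + n) (by omega) hn)
  have down₁ : ∀ n, P (i + n) j → P i j := fun n => by
    induction n with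
    | zero => exact id
    | succ n ih => exact fun hn => ih (h₂ (i + n) j (by omega) hn)
  have hj : P (a + (N + i)) j := by
    rcases Nat.le_total b j with hbj | hbj
    · simpa [Nat.add_sub_cancel' hbj] using up₂ (j - b)
    · exact down₂ (b - j) (by simpa [Nat.add_sub_cancel' hbj] using up₂ 0)
  exact down₁ (a + N) (by rwa [show i + (a + N) = a + (N + i) by omega])

/-- An infinite set which is, up to finitely many elements, invariant under all translations
contains all but finitely many elements of each `B_ω^{F}`. -/
theorem exists_forall_mem_of_almost_invariant (hcl : OmegaClosed 𝓕)
    (hne : ∀ F ∈ 𝓕, F.Nonempty) (hind : ∀ F ∈ 𝓕, InductiveSet F) {C : Set (BF0 𝓕)}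
    (hC : C.Infinite)
    (hl : ∀ a, (C \ (fun x => BF0mul hcl a x) ⁻¹' C).Finite)
    (hr : ∀ a, (C \ (fun x => BF0mul hcl x a) ⁻¹' C).Finite)
    {m : ℕ} (hm : Set.Ici m ∈ 𝓕) :
    ∃ N, ∀ i j, N ≤ i + j → mk i j m hm ∈ C := by
  classical
  have hex : ∃ k, Set.Ici k ∈ 𝓕 := ⟨m, hm⟩
  obtain ⟨k₀, hk₀, hmin⟩ : ∃ k₀, Set.Ici k₀ ∈ 𝓕 ∧ ∀ k, Set.Ici k ∈ 𝓕 → k₀ ≤ k :=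
    ⟨Nat.find hex, Nat.find_spec hex, fun k hk => Nat.find_min' hex hk⟩
  obtain ⟨N, hN⟩ := exists_bound ((((hl (mk 1 0 k₀ hk₀)).union (hl (mk 0 1 k₀ hk₀))).union
    (hr (mk 0 1 k₀ hk₀))).union (hr (mk 1 0 k₀ hk₀)))
  simp only [Set.mem_union, Set.mem_sdiff, Set.mem_preimage, not_or, not_and, not_not] at hN
  have spread : ∀ {k a b : ℕ} (hk : Set.Ici k ∈ 𝓕), N ≤ a + b + k → mk a b k hk ∈ C →
      ∀ i j, N ≤ i + j + k → mk i j k hk ∈ C := by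
    intro k a b hk hab h i j hij
    have hk₀k := hmin k hk
    refine forall_of_unit_steps (P := fun i j => mk i j k hk ∈ C) (N := N - k)
      ?_ ?_ ?_ ?_ (a := a) (b := b) (by omega) h (by omega)
    · intro i j hij h
      have := (hN i j k hk (by omega)).1.1.1 h
      rwa [mul_mk hcl hk₀ hk hk (s := i + 1) (t := j) (by omega) (by omega) (by omega)] at this
    · intro i j hij h
      have := (hN (i + 1) j k hk (by omega)).1.1.2 h
      rwa [mul_mk hcl hk₀ hk hk (s := i) (t := j) (by omega) (by omega) (by omega)] at this
    · intro i j hij h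
      have := (hN i j k hk (by omega)).1.2 h
      rwa [mul_mk hcl hk hk₀ hk (s := i) (t := j + 1) (by omega) (by omega) (by omega)] at this
    · intro i j hij h
      have := (hN i (j + 1) k hk (by omega)).2 h
      rwa [mul_mk hcl hk hk₀ hk (s := i) (t := j) (by omega) (by omega) (by omega)] at this
  obtain ⟨i, j, k, hk, hmem, hlt⟩ : ∃ i j k h, mk i j k h ∈ C ∧ N < i + j + k := by
    by_contra! hcon
    exact hC (finite_of_bounded hne hind N hcon)
  obtain ⟨M, hM⟩ := exists_bound (hl (mk 0 (k - m) m hm))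
  simp only [Set.mem_sdiff, Set.mem_preimage, not_and, not_not] at hM
  have hm' := hM 0 (N + M) k hk (by omega) (spread hk hlt.le hmem 0 (N + M) (by omega))
  rw [mul_mk hcl hm hk hm (s := 0) (t := N + M + (k - m)) (by omega) (by omega)
    (by omega)] at hm'
  exact ⟨N, fun i j hij => spread hm (by omega) hm' i j (by omega)⟩

end BF0

/-- Lemma 3.4: if `S = B_ω^𝓕 ∪ {0}` carries a Hausdorff locally compact
shift-continuous topology with nonisolated zero, then for every neighbourhood `U`
of the zero and every `F ∈ 𝓕`, the set `B_ω^{F} \ U` is finite, where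
`B_ω^{F} = {(i,j,F) : i,j ∈ ω}`. -/
theorem statement8 (𝓕 : Set (Set ℕ)) (hcl : OmegaClosed 𝓕)
    (hne : ∀ F ∈ 𝓕, F.Nonempty) (hind : ∀ F ∈ 𝓕, InductiveSet F)
    (τ : TopologicalSpace (BF0 𝓕)) (hT2 : @T2Space _ τ)
    (hlc : @LocallyCompactSpace _ τ)
    (hsc : ∀ a : BF0 𝓕, @Continuous _ _ τ τ (fun x => BF0mul hcl a x) ∧
        @Continuous _ _ τ τ (fun x => BF0mul hcl x a))
    (hni : ¬ @IsOpen _ τ {(none : BF0 𝓕)})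
    (U : Set (BF0 𝓕)) (hU : U ∈ @nhds _ τ none)
    (F : Set ℕ) (hF : F ∈ 𝓕) :
    ({x : BF0 𝓕 | ∃ i j : ℕ, x = some (i, j, ⟨F, hF⟩)} \ U).Finite := by
  have hiso : ∀ x : BF0 𝓕, x ≠ none → IsOpen {x} := fun x hx =>
    BF0.isOpen_singleton_of_ne_none hcl hne hind hsc hni hx
  obtain ⟨C, hC, hCU, hcomp⟩ := LocallyCompactSpace.local_compact_nhds none U hU
  have hinf : C.Infinite := fun hfin => hni <| by
    have h : C \ (C \ {none}) ∈ nhds (none : BF0 𝓕) :=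
      Filter.sdiff_mem hC <|
        (hfin.subset Set.sdiff_subset).isClosed.isOpen_compl.mem_nhds (by simp)
    rw [Set.sdiff_sdiff_right_self] at h
    exact isOpen_singleton_iff_nhds_eq_pure _ |>.2 <| le_antisymm
      (Filter.le_pure_iff.2 (Filter.mem_of_superset h Set.inter_subset_right)) (pure_le_nhds _)
  have hinv : ∀ f : BF0 𝓕 → BF0 𝓕, Continuous f → f none = none → (C \ f ⁻¹' C).Finite :=
    fun f hf h0 => BF0.finite_diff_of_isCompact hiso hcomp
      (hf.continuousAt.preimage_mem_nhds (by rwa [h0]))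
  obtain ⟨m, rfl⟩ : ∃ m, F = Set.Ici m := ⟨_, (hind F hF).eq_Ici (hne F hF)⟩
  obtain ⟨N, hN⟩ := BF0.exists_forall_mem_of_almost_invariant hcl hne hind hinf
    (fun a => hinv _ (hsc a).1 (BF0.mul_none hcl a))
    (fun a => hinv _ (hsc a).2 (BF0.none_mul hcl a)) hF
  refine BF0.finite_of_bounded hne hind (N + m) ?_
  rintro i j k h ⟨⟨p, q, e⟩, hU'⟩
  obtain ⟨rfl, rfl, rfl⟩ := BF0.mk_inj (h' := hF) e
  by_contra hlt
  exact hU' (hCU (hN i j (by omega)))
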